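/- arXiv:2503.04583 — 3 statements merged into one kernel-verified Lean document; each statement's English description precedes it below -/
import Mathlib

section
/- Let G be a network (a finite, strongly connected directed multigraph without self-loops). Then there exists a deadlock-free routing scheme for G if and only if there exist a vertex v, a spanning in-tree of G rooted at v, and a spanning out-tree of G rooted at v that are edge-disjoint (the two edge sets are disjoint). -/
/-- `p` is a directed path from `u` to `w` in the directed multigraph given by
`src, tgt : E → V`: a nonempty list of edges where the target of each edge equals the
source of the next, starting at `u` and ending at `w`. -/
def IsPathFrom {V E : Type*} (src tgt : E → V) (u w : V) (p : List E) : Prop :=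
  p ≠ [] ∧ p.Chain' (fun e₁ e₂ => tgt e₁ = src e₂) ∧
    p.head?.map src = some u ∧ p.getLast?.map tgt = some w

/-- `w` is reachable from `u` by a directed path using only edges from `A`. -/
def ReachableVia {V E : Type*} (src tgt : E → V) (A : Set E) (u w : V) : Prop :=
  ∃ p : List E, (∀ e ∈ p, e ∈ A) ∧ IsPathFrom src tgt u w p

/-- The graph is strongly connected: every vertex reaches every other vertex. -/
def StronglyConnected {V E : Type*} (src tgt : E → V) : Prop :=
  ∀ u w : V, u ≠ w → ReachableVia src tgt Set.univ u w

/-- `route` is a routing scheme: it assigns to every ordered pair of distinct vertices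
a directed path between them. -/
def IsRouting {V E : Type*} (src tgt : E → V) (route : ∀ u w : V, u ≠ w → List E) : Prop :=
  ∀ (u w : V) (h : u ≠ w), IsPathFrom src tgt u w (route u w h)

/-- The dependency relation of a routing scheme: `Dep route e₁ e₂` iff `e₂` immediately
follows `e₁` on some routing path. -/
def Dep {V E : Type*} (route : ∀ u w : V, u ≠ w → List E) (e₁ e₂ : E) : Prop :=
  ∃ (u w : V) (h : u ≠ w), [e₁, e₂] <:+: route u w h

/-- A routing scheme is deadlock-free iff its dependency relation is acyclic. -/
def DeadlockFree {V E : Type*} (route : ∀ u w : V, u ≠ w → List E) : Prop :=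
  Irreflexive (Relation.TransGen (Dep route))

/-- `T` is a spanning in-tree rooted at `v`: it has exactly `|V| - 1` edges and every
vertex other than `v` has a directed path to `v` using only edges of `T`. -/
def IsInTree {V E : Type*} [Fintype V] (src tgt : E → V) (v : V) (T : Finset E) : Prop :=
  T.card = Fintype.card V - 1 ∧ ∀ u : V, u ≠ v → ReachableVia src tgt ↑T u v

/-- `T` is a spanning out-tree rooted at `v`: it has exactly `|V| - 1` edges and every
vertex other than `v` is reachable from `v` by a directed path using only edges of `T`. -/
def IsOutTree {V E : Type*} [Fintype V] (src tgt : E → V) (v : V) (T : Finset E) : Prop :=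
  T.card = Fintype.card V - 1 ∧ ∀ w : V, w ≠ v → ReachableVia src tgt ↑T v w

/-- A linear order on `E` respects a routing scheme if `e₁ < e₂` whenever `e₂`
immediately follows `e₁` on some routing path. -/
def RespectsRouting {V E : Type*} (route : ∀ u w : V, u ≠ w → List E)
    (ord : LinearOrder E) : Prop :=
  ∀ e₁ e₂ : E, Dep route e₁ e₂ → ord.lt e₁ e₂

/-- The set of the `s` smallest edges of a linear order on `E`. -/
def smallestEdges {E : Type*} (ord : LinearOrder E) (s : ℕ) : Set E :=
  {e | {e' | ord.le e' e}.ncard ≤ s}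

/-- `v` is a global attractor of the subgraph with edge set `A`: it is reachable from
every other vertex by a directed path using only edges of `A`. -/
def IsGlobalAttractor {V E : Type*} (src tgt : E → V) (A : Set E) (v : V) : Prop :=
  ∀ u : V, u ≠ v → ReachableVia src tgt A u v

/-- The attraction number of a linear order on `E`: the least `s` such that the subgraph
consisting of the `s` smallest edges has a global attractor. -/
noncomputable def attractionNumber {V E : Type*} (src tgt : E → V) (ord : LinearOrder E) : ℕ :=
  sInf {s | ∃ v : V, IsGlobalAttractor src tgt (smallestEdges ord s) v}

section Paths

variable {V E : Type*} {src tgt : E → V}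

theorem isPathFrom_cons {u w : V} {e : E} {q : List E} :
    IsPathFrom src tgt u w (e :: q) ↔
      src e = u ∧ ((q = [] ∧ tgt e = w) ∨ IsPathFrom src tgt (tgt e) w q) := by
  cases q with
  | nil => simp [IsPathFrom, List.Chain']
  | cons f q =>
    simp only [IsPathFrom, List.Chain', List.isChain_cons_cons, List.getLast?_cons_cons]
    simp
    tauto

theorem IsPathFrom.reverse {u w : V} {p : List E} (h : IsPathFrom src tgt u w p) :
    IsPathFrom tgt src w u p.reverse := by
  obtain ⟨h1, h2, h3, h4⟩ := h
  refine ⟨by simpa using h1, ?_, by simpa using h4, by simpa using h3⟩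
  exact List.isChain_reverse.2 (h2.imp fun _ _ h => h.symm)

theorem IsPathFrom.append {u v w : V} {p q : List E} (hp : IsPathFrom src tgt u v p)
    (hq : IsPathFrom src tgt v w q) : IsPathFrom src tgt u w (p ++ q) := by
  induction p generalizing u with
  | nil => exact absurd rfl hp.1
  | cons e p ih =>
    obtain ⟨h1, ⟨rfl, rfl⟩ | h2⟩ := isPathFrom_cons.1 hp
    · exact isPathFrom_cons.2 ⟨h1, Or.inr hq⟩
    · exact isPathFrom_cons.2 ⟨h1, Or.inr (ih h2)⟩

theorem isPathFrom_singleton (e : E) : IsPathFrom src tgt (src e) (tgt e) [e] :=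
  isPathFrom_cons.2 ⟨rfl, Or.inl ⟨rfl, rfl⟩⟩

theorem ReachableVia.reverse {A : Set E} {u w : V} (h : ReachableVia src tgt A u w) :
    ReachableVia tgt src A w u := by
  obtain ⟨p, hA, hp⟩ := h
  exact ⟨p.reverse, by simpa using hA, hp.reverse⟩

/-- A global attractor admits a potential that some outgoing edge of every other vertex
decreases. -/
theorem IsGlobalAttractor.exists_potential {A : Set E} {v : V}
    (h : IsGlobalAttractor src tgt A v) :
    ∃ d : V → ℕ, ∀ u, u ≠ v → ∃ e ∈ A, src e = u ∧ d (tgt e) < d u := by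
  classical
  let S : V → Set ℕ := fun u =>
    {n | ∃ p : List E, p.length = n ∧ (∀ e ∈ p, e ∈ A) ∧ IsPathFrom src tgt u v p}
  refine ⟨fun u => if u = v then 0 else sInf (S u), fun u hu => ?_⟩
  have hne : (S u).Nonempty := by
    obtain ⟨p, hA, hp⟩ := h u hu
    exact ⟨_, p, rfl, hA, hp⟩
  obtain ⟨p, hlen, hA, hp⟩ := Nat.sInf_mem hne
  cases p with
  | nil => exact absurd rfl hp.1
  | cons e q =>
    obtain ⟨h1, h2⟩ := isPathFrom_cons.1 hp
    refine ⟨e, hA e (by simp), h1, ?_⟩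
    simp only [if_neg hu, ← hlen, List.length_cons]
    split_ifs with hv
    · omega
    · obtain ⟨-, h3⟩ | h3 := h2
      · exact absurd h3 hv
      · have : sInf (S (tgt e)) ≤ q.length :=
          Nat.sInf_le ⟨q, rfl, fun f hf => hA f (by simp [hf]), h3⟩
        omega

/-- Following potential-decreasing edges leads to the target. -/
theorem exists_path_of_potential {A : Set E} {v : V} {d : V → ℕ}
    (hd : ∀ u, u ≠ v → ∃ e ∈ A, src e = u ∧ d (tgt e) < d u) (u : V) (hu : u ≠ v) :
    ∃ p : List E, (∀ e ∈ p, e ∈ A ∧ src e ≠ v) ∧ IsPathFrom src tgt u v p ∧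
      p.IsChain (fun e f => d (src f) < d (src e)) := by
  induction hn : d u using Nat.strong_induction_on generalizing u with
  | _ n ih =>
    obtain ⟨e, heA, rfl, hlt⟩ := hd u hu
    by_cases hv : tgt e = v
    · exact ⟨[e], by simp [heA, hu], hv ▸ isPathFrom_singleton e, by simp⟩
    · obtain ⟨p, hpA, hp, hc⟩ := ih _ (hn ▸ hlt) (tgt e) hv rfl
      refine ⟨e :: p, ?_, isPathFrom_cons.2 ⟨rfl, Or.inr hp⟩, ?_⟩
      · simpa [heA, hu] using hpA
      · cases p with
        | nil => simp
        | cons f p =>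
          rw [List.isChain_cons_cons]
          exact ⟨by rwa [(isPathFrom_cons.1 hp).1], hc⟩

theorem IsGlobalAttractor.exists_inTree [Fintype V] {A : Set E} {v : V}
    (h : IsGlobalAttractor src tgt A v) :
    ∃ T : Finset E, ↑T ⊆ A ∧ IsInTree src tgt v T := by
  classical
  obtain ⟨d, hd⟩ := h.exists_potential
  choose e heA hsrc hlt using hd
  let f : {u // u ≠ v} → E := fun u => e u.1 u.2
  have hinj : Function.Injective f := fun a b hab =>
    Subtype.ext (by rw [← hsrc a.1 a.2, ← hsrc b.1 b.2]; exact congrArg src hab)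
  refine ⟨Finset.univ.image f, ?_, ?_, fun u hu => ?_⟩
  · intro x hx
    obtain ⟨u, rfl⟩ : ∃ u, f u = x := by simpa using hx
    exact heA _ _
  · rw [Finset.card_image_of_injective _ hinj, Finset.card_univ, Fintype.card_subtype_compl]
    simp
  · obtain ⟨p, hp, hpath, -⟩ := exists_path_of_potential (src := src) (tgt := tgt)
      (A := ↑(Finset.univ.image f)) (v := v) (d := d)
      (fun u hu => ⟨e u hu, by
        simpa using ⟨u, hu, rfl⟩, hsrc u hu, hlt u hu⟩) u hu
    exact ⟨p, fun x hx => (hp x hx).1, hpath⟩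

/-- The head of an edge leaving a global attractor is again a global attractor. -/
theorem IsGlobalAttractor.tgt_of_src {A : Set E} {e : E} (he : e ∈ A)
    (h : IsGlobalAttractor src tgt A (src e)) : IsGlobalAttractor src tgt A (tgt e) := by
  intro u _
  by_cases hu : u = src e
  · exact ⟨[e], by simpa using he, hu ▸ isPathFrom_singleton e⟩
  · obtain ⟨p, hA, hp⟩ := h u hu
    refine ⟨p ++ [e], ?_, hp.append (isPathFrom_singleton e)⟩
    intro x hx
    rcases List.mem_append.1 hx with hx | hx
    · exact hA x hx
    · rwa [List.mem_singleton.1 hx]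

/-- Edges leaving a global attractor may be discarded. -/
theorem IsGlobalAttractor.discard {A : Set E} {v : V} (h : IsGlobalAttractor src tgt A v) :
    IsGlobalAttractor src tgt {e ∈ A | src e ≠ v} v := by
  obtain ⟨d, hd⟩ := h.exists_potential
  intro u hu
  obtain ⟨p, hp, hpath, -⟩ := exists_path_of_potential hd u hu
  exact ⟨p, hp, hpath⟩

theorem isChain_dep (route : ∀ u w : V, u ≠ w → List E) (u w : V) (h : u ≠ w) :
    (route u w h).IsChain (Dep route) := by
  rw [List.isChain_iff_forall_rel_of_append_cons_cons]
  intro a b l₁ l₂ hl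
  exact ⟨u, w, h, l₁, l₂, by simp [hl]⟩

/-- Some set of edges closed under predecessors has a global attractor that no edge of the
set leaves. -/
theorem exists_attractor_without_exit [Finite E] [Nonempty V]
    (hconn : StronglyConnected src tgt) {D : E → E → Prop}
    (hD : ∀ e, ¬ Relation.TransGen D e e) (hDsrc : ∀ e f, D e f → tgt e = src f) :
    ∃ (A : Set E) (v : V), IsGlobalAttractor src tgt A v ∧
      (∀ e f, D e f → f ∈ A → e ∈ A) ∧ ∀ e ∈ A, src e ≠ v := by
  let P : Set E → Prop := fun A =>
    (∃ v, IsGlobalAttractor src tgt A v) ∧ ∀ e f, D e f → f ∈ A → e ∈ A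
  obtain ⟨v₀⟩ := ‹Nonempty V›
  obtain ⟨A, ⟨⟨v, hv⟩, hdown⟩, hmin⟩ := exists_minimal_of_wellFoundedLT P
    ⟨Set.univ, ⟨v₀, fun u hu => hconn u v₀ hu⟩, fun _ _ _ _ => trivial⟩
  refine ⟨A, v, hv, hdown, fun e₀ he₀ hsrc => ?_⟩
  have : Std.Irrefl (fun e f => Relation.TransGen D f e) := ⟨hD⟩
  have : IsTrans E (fun e f => Relation.TransGen D f e) := ⟨fun _ _ _ h h' => h'.trans h⟩
  obtain ⟨e, ⟨heA, hatt⟩, hmax⟩ :=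
    (Finite.wellFounded_of_trans_of_irrefl (fun e f => Relation.TransGen D f e)).has_min
      {e | e ∈ A ∧ IsGlobalAttractor src tgt A (src e)} ⟨e₀, he₀, hsrc ▸ hv⟩
  have hP : P (A \ {e}) := by
    refine ⟨⟨src e, fun u hu => ?_⟩, fun x y hxy hy => ⟨hdown x y hxy hy.1, ?_⟩⟩
    · obtain ⟨p, hp, hpath⟩ := hatt.discard u hu
      exact ⟨p, fun x hx => ⟨(hp x hx).1, fun hxe => (hp x hx).2 (congrArg src hxe)⟩, hpath⟩
    · rintro rfl
      exact hmax y ⟨hy.1, hDsrc _ _ hxy ▸ hatt.tgt_of_src heA⟩ (.single hxy)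
  exact (hmin hP Set.sdiff_subset heA).2 rfl

theorem exists_two_trees [Fintype V] [Nonempty V] [Finite E]
    (hconn : StronglyConnected src tgt) {route : ∀ u w : V, u ≠ w → List E}
    (hroute : IsRouting src tgt route) (hfree : ∀ e, ¬ Relation.TransGen (Dep route) e e) :
    ∃ (v : V) (Tin Tout : Finset E), IsInTree src tgt v Tin ∧ IsOutTree src tgt v Tout ∧
      Disjoint Tin Tout := by
  obtain ⟨A, v, hatt, hdown, hexit⟩ := exists_attractor_without_exit hconn hfree (by
    rintro e f ⟨u, w, h, hinf⟩
    simpa using List.IsChain.infix (hroute u w h).2.1 hinf)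
  have hout : IsGlobalAttractor tgt src Aᶜ v := by
    intro w hw
    refine ReachableVia.reverse ⟨route v w hw.symm, ?_, hroute v w hw.symm⟩
    have hstep := isChain_dep route v w hw.symm
    have hpath := hroute v w hw.symm
    generalize route v w hw.symm = p at hstep hpath
    cases p with
    | nil => simp
    | cons e p =>
      refine hstep.induction (· ∈ Aᶜ) _ (fun x y hxy hx hy => hx (hdown x y hxy hy)) ?_
      intro _ heA
      exact hexit e heA (isPathFrom_cons.1 hpath).1
  obtain ⟨Tin, hTin, hin⟩ := hatt.exists_inTree
  obtain ⟨Tout, hTout, hcard, hreach⟩ := hout.exists_inTree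
  exact ⟨v, Tin, Tout, hin, ⟨hcard, fun w hw => (hreach w hw).reverse⟩,
    Finset.disjoint_left.2 fun e h1 h2 => hTout h2 (hTin h1)⟩

theorem deadlockFree_of_rank {route : ∀ u w : V, u ≠ w → List E} (r : E → ℤ)
    (hr : ∀ u w h, (route u w h).IsChain (fun e f => r e < r f)) :
    ∀ e, ¬ Relation.TransGen (Dep route) e e := by
  have key : ∀ e f, Relation.TransGen (Dep route) e f → r e < r f := by
    intro e f hef
    induction hef using Relation.TransGen.trans_induction_on with
    | single h =>
      obtain ⟨u, w, h, hinf⟩ := h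
      simpa using List.IsChain.infix (hr u w h) hinf
    | trans _ _ h1 h2 => exact h1.trans h2
  exact fun e he => lt_irrefl _ (key e e he)

theorem exists_deadlockFree_routing {v : V} {A B : Set E} (hAB : Disjoint A B)
    (hin : IsGlobalAttractor src tgt A v) (hout : IsGlobalAttractor tgt src B v) :
    ∃ route : ∀ u w : V, u ≠ w → List E, IsRouting src tgt route ∧
      ∀ e, ¬ Relation.TransGen (Dep route) e e := by
  classical
  obtain ⟨d, hd⟩ := hin.exists_potential
  obtain ⟨d', hd'⟩ := hout.exists_potential
  choose p hpA hp hpc using exists_path_of_potential hd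
  choose q hqB hq hqc using exists_path_of_potential hd'
  let r : E → ℤ := fun e => if e ∈ A then -(d (src e) : ℤ) - 1 else d' (tgt e)
  have hrA : ∀ e ∈ A, r e = -(d (src e) : ℤ) - 1 := fun e he => if_pos he
  have hrB : ∀ e ∈ B, r e = d' (tgt e) := fun e he => if_neg (hAB.notMem_of_mem_right he)
  have hpr : ∀ u hu, (p u hu).IsChain (fun e f => r e < r f) := fun u hu =>
    (hpc u hu).imp_of_mem_imp fun e f he hf h => by
      rw [hrA e (hpA u hu e he).1, hrA f (hpA u hu f hf).1]; omega
  have hqr : ∀ w hw, (q w hw).reverse.IsChain (fun e f => r e < r f) := fun w hw =>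
    List.isChain_reverse.2 <| (hqc w hw).imp_of_mem_imp fun e f he hf h => by
      rw [hrB e (hqB w hw e he).1, hrB f (hqB w hw f hf).1]; omega
  refine ⟨fun u w h => if hu : u = v then q w (fun hw => h (hu.trans hw.symm)) |>.reverse
    else if hw : w = v then p u hu else p u hu ++ (q w hw).reverse, ?_, ?_⟩
  · intro u w h
    dsimp only
    split_ifs with hu hw
    · subst hu
      exact (hq w _).reverse
    · subst hw
      exact hp u hu
    · exact (hp u hu).append (hq w hw).reverse
  · refine deadlockFree_of_rank r fun u w h => ?_
    split_ifs with hu hw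
    · exact hqr w _
    · exact hpr u hu
    · refine (hpr u hu).append (hqr w hw) fun e he f hf => ?_
      rw [hrA e (hpA u hu e (List.mem_of_mem_getLast? he)).1,
        hrB f (hqB w hw f (List.mem_reverse.1 (List.mem_of_mem_head? hf))).1]
      omega

end Paths

/-- Deadlock-free routing exists for a network iff it contains two edge-disjoint
directed spanning trees rooted at the same vertex, one directed into the root and
the other directed away from it. -/
theorem deadlockFree_routing_iff_two_trees
    {V E : Type*} [Fintype V] [Nonempty V] [Fintype E] (src tgt : E → V)
    (hloop : ∀ e : E, src e ≠ tgt e) (hconn : StronglyConnected src tgt) :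
    (∃ route : ∀ u w : V, u ≠ w → List E, IsRouting src tgt route ∧ DeadlockFree route) ↔
    (∃ (v : V) (Tin Tout : Finset E), IsInTree src tgt v Tin ∧ IsOutTree src tgt v Tout ∧
      Disjoint Tin Tout) := by
  constructor
  · rintro ⟨route, hroute, hfree⟩
    exact exists_two_trees hconn hroute hfree
  · rintro ⟨v, Tin, Tout, hin, hout, hdisj⟩
    exact exists_deadlockFree_routing (Finset.disjoint_coe.2 hdisj) hin.2
      fun w hw => (hout.2 w hw).reverse
end

section
/- Let G be a network (a finite, strongly connected directed multigraph without self-loops) that admits a deadlock-free routing scheme. Then there exist a vertex v, a spanning in-tree of G rooted at v, and a spanning out-tree of G rooted at v whose edge sets are disjoint. -/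
/-- `Step src tgt A u w` holds when some edge of `A` goes from `u` to `w`. -/
def Step {V E : Type*} (src tgt : E → V) (A : Set E) (u w : V) : Prop :=
  ∃ e ∈ A, src e = u ∧ tgt e = w

theorem Step.mono {V E : Type*} {src tgt : E → V} {A B : Set E} (hAB : A ⊆ B) {u w : V}
    (h : Step src tgt A u w) : Step src tgt B u w := by
  obtain ⟨e, he, h⟩ := h
  exact ⟨e, hAB he, h⟩

theorem ReachableVia.transGen {V E : Type*} {src tgt : E → V} {A : Set E} {u w : V}
    (h : ReachableVia src tgt A u w) : Relation.TransGen (Step src tgt A) u w := by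
  obtain ⟨p, hA, hne, hchain, hhead, hlast⟩ := h
  induction p generalizing u with
  | nil => exact absurd rfl hne
  | cons e p ih =>
    have hu : src e = u := by simpa using hhead
    cases p with
    | nil => exact .single ⟨e, hA e (by simp), hu, by simpa using hlast⟩
    | cons f q =>
      rw [List.Chain', List.isChain_cons_cons] at hchain
      exact .head ⟨e, hA e (by simp), hu, rfl⟩
        (ih (fun x hx => hA x (List.mem_cons_of_mem _ hx)) (by simp) hchain.2
          (by simp [hchain.1]) (by simpa using hlast))

theorem reachableVia_of_transGen {V E : Type*} {src tgt : E → V} {A : Set E} {u w : V}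
    (h : Relation.TransGen (Step src tgt A) u w) : ReachableVia src tgt A u w := by
  induction h using Relation.TransGen.head_induction_on with
  | single h =>
    obtain ⟨e, he, hs, ht⟩ := h
    exact ⟨[e], by simpa using he, by simp, List.isChain_singleton _, by simp [hs], by simp [ht]⟩
  | head h _ ih =>
    obtain ⟨e, he, hs, ht⟩ := h
    obtain ⟨p, hA, hne, hchain, hhead, hlast⟩ := ih
    cases p with
    | nil => exact absurd rfl hne
    | cons f q =>
      have hf : src f = tgt e := by rw [ht]; simpa using hhead
      refine ⟨e :: f :: q, ?_, by simp, ?_, by simp [hs], by simpa using hlast⟩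
      · intro x hx
        rcases List.mem_cons.1 hx with rfl | hx
        · exact he
        · exact hA x hx
      · exact List.isChain_cons_cons.2 ⟨hf.symm, hchain⟩

theorem reachableVia_of_reflTransGen {V E : Type*} {src tgt : E → V} {A : Set E} {u w : V}
    (hne : u ≠ w) (h : Relation.ReflTransGen (Step src tgt A) u w) :
    ReachableVia src tgt A u w := by
  rcases Relation.reflTransGen_iff_eq_or_transGen.1 h with h | h
  · exact absurd h.symm hne
  · exact reachableVia_of_transGen h

theorem IsGlobalAttractor.reflTransGen {V E : Type*} {src tgt : E → V} {A : Set E} {v : V}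
    (h : IsGlobalAttractor src tgt A v) (u : V) :
    Relation.ReflTransGen (Step src tgt A) u v := by
  by_cases huv : u = v
  · rw [huv]
  · exact (h u huv).transGen.to_reflTransGen

/-- A walk ending at `v` that starts outside a set containing `v` enters that set. -/
theorem exists_entering_edge {V E : Type*} {src tgt : E → V} {A : Set E} {S : Set V} {u v : V}
    (h : Relation.ReflTransGen (Step src tgt A) u v) (hu : u ∉ S) (hv : v ∈ S) :
    ∃ e ∈ A, src e ∉ S ∧ tgt e ∈ S := by
  induction h using Relation.ReflTransGen.head_induction_on with
  | refl => exact absurd hv hu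
  | @head a c hac _ ih =>
    obtain ⟨e, he, rfl, rfl⟩ := hac
    by_cases hc : tgt e ∈ S
    · exact ⟨e, he, hu, hc⟩
    · exact ih hc

/-- If every vertex reaches `v` inside `A`, then `A` contains a spanning tree directed
towards `v`. -/
theorem exists_spanning_tree {V E : Type*} [Fintype V] {src tgt : E → V} {A : Set E} {v : V}
    (h : ∀ u, Relation.ReflTransGen (Step src tgt A) u v) :
    ∃ T : Finset E, (T : Set E) ⊆ A ∧ T.card = Fintype.card V - 1 ∧
      ∀ u, Relation.ReflTransGen (Step src tgt (T : Set E)) u v := by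
  classical
  have grow : ∀ k, k + 1 ≤ Fintype.card V → ∃ (S : Finset V) (T : Finset E),
      v ∈ S ∧ S.card = k + 1 ∧ T.card = k ∧ (T : Set E) ⊆ A ∧ (∀ e ∈ T, src e ∈ S) ∧
      ∀ u ∈ S, Relation.ReflTransGen (Step src tgt (T : Set E)) u v := by
    intro k
    induction k with
    | zero =>
      intro _
      refine ⟨{v}, ∅, by simp, by simp, by simp, by simp, by simp, ?_⟩
      intro u hu
      rw [Finset.mem_singleton.1 hu]
    | succ k ih =>
      intro hk
      obtain ⟨S, T, hv, hS, hT, hTA, hsrc, hreach⟩ := ih (by omega)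
      obtain ⟨u, hu⟩ : ∃ u, u ∉ S := by
        by_contra! hall
        rw [Finset.eq_univ_iff_forall.2 hall, Finset.card_univ] at hS
        omega
      obtain ⟨e, he, hes, het⟩ := exists_entering_edge (S := (S : Set V)) (h u) hu hv
      have heT : e ∉ T := fun h => hes (hsrc e h)
      have hsub : (T : Set E) ⊆ ((insert e T : Finset E) : Set E) := by simp
      have hlift : ∀ w ∈ S,
          Relation.ReflTransGen (Step src tgt ((insert e T : Finset E) : Set E)) w v :=
        fun w hw => Relation.ReflTransGen.mono (fun _ _ => Step.mono hsub) _ _ (hreach w hw)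
      refine ⟨insert (src e) S, insert e T, Finset.mem_insert_of_mem hv, ?_, ?_, ?_, ?_, ?_⟩
      · rw [Finset.card_insert_of_notMem hes, hS]
      · rw [Finset.card_insert_of_notMem heT, hT]
      · rw [Finset.coe_insert]
        exact Set.insert_subset he hTA
      · intro f hf
        rcases Finset.mem_insert.1 hf with rfl | hf
        · exact Finset.mem_insert_self _ _
        · exact Finset.mem_insert_of_mem (hsrc f hf)
      · intro w hw
        rcases Finset.mem_insert.1 hw with rfl | hw
        · exact .head ⟨e, by simp, rfl, rfl⟩ (hlift _ het)
        · exact hlift w hw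
  have hpos : 0 < Fintype.card V := Fintype.card_pos_iff.2 ⟨v⟩
  obtain ⟨S, T, -, hS, hT, hTA, -, hreach⟩ := grow (Fintype.card V - 1) (by omega)
  have hSuniv : S = Finset.univ := Finset.card_eq_iff_eq_univ S |>.1 (by omega)
  exact ⟨T, hTA, hT, fun u => hreach u (by simp [hSuniv])⟩

theorem exists_isInTree {V E : Type*} [Fintype V] {src tgt : E → V} {A : Set E} {v : V}
    (h : IsGlobalAttractor src tgt A v) :
    ∃ T : Finset E, (T : Set E) ⊆ A ∧ IsInTree src tgt v T := by
  obtain ⟨T, hTA, hcard, hreach⟩ := exists_spanning_tree h.reflTransGen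
  exact ⟨T, hTA, hcard, fun u hu => reachableVia_of_reflTransGen hu (hreach u)⟩

theorem step_swap {V E : Type*} (src tgt : E → V) (A : Set E) :
    Function.swap (Step src tgt A) = Step tgt src A := by
  funext u w
  simp only [Function.swap, Step, and_comm]

theorem exists_isOutTree {V E : Type*} [Fintype V] {src tgt : E → V} {A : Set E} {v : V}
    (h : ∀ w, w ≠ v → ReachableVia src tgt A v w) :
    ∃ T : Finset E, (T : Set E) ⊆ A ∧ IsOutTree src tgt v T := by
  have hrev : ∀ w, Relation.ReflTransGen (Step tgt src A) w v := by
    intro w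
    rw [← step_swap, Relation.reflTransGen_swap]
    by_cases hw : w = v
    · rw [hw]
    · exact (h w hw).transGen.to_reflTransGen
  obtain ⟨T, hTA, hcard, hreach⟩ := exists_spanning_tree hrev
  refine ⟨T, hTA, hcard, fun w hw => reachableVia_of_reflTransGen hw.symm ?_⟩
  rw [← Relation.reflTransGen_swap, step_swap]
  exact hreach w

/-- Edges leaving the end vertex of a walk are not needed to reach it. -/
theorem reflTransGen_step_diff {V E : Type*} {src tgt : E → V} {A : Set E} {e : E} {u : V}
    (h : Relation.ReflTransGen (Step src tgt A) u (src e)) :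
    Relation.ReflTransGen (Step src tgt (A \ {e})) u (src e) := by
  induction h using Relation.ReflTransGen.head_induction_on with
  | refl => exact .refl
  | @head a c hac _ ih =>
    obtain ⟨f, hf, rfl, rfl⟩ := hac
    by_cases hfe : f = e
    · rw [hfe]
    · exact .head ⟨f, ⟨hf, hfe⟩, rfl, rfl⟩ ih

theorem Dep.tgt_eq_src {V E : Type*} {src tgt : E → V} {route : ∀ u w : V, u ≠ w → List E}
    (hroute : IsRouting src tgt route) {e f : E} (h : Dep route e f) : tgt e = src f := by
  obtain ⟨u, w, huw, hinfix⟩ := h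
  exact List.isChain_pair (R := fun e f => tgt e = src f) |>.1 ((hroute u w huw).2.1.infix hinfix)

theorem isChain_dep_route {V E : Type*} (route : ∀ u w : V, u ≠ w → List E) (u w : V)
    (h : u ≠ w) : (route u w h).IsChain (Dep route) :=
  List.isChain_iff_forall_rel_of_append_cons_cons.2 fun {a b l₁ l₂} hl =>
    ⟨u, w, h, l₁, l₂, by simp [hl]⟩

/-- A deadlock-free routing scheme has a set of edges `D`, closed under predecessors in the
dependency relation, with a global attractor that no edge of `D` leaves. -/
theorem exists_attractor_without_outgoing {V E : Type*} [Nonempty V] [Finite E]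
    {src tgt : E → V} (hconn : StronglyConnected src tgt)
    {route : ∀ u w : V, u ≠ w → List E} (hroute : IsRouting src tgt route)
    (hdf : DeadlockFree route) :
    ∃ (D : Set E) (v : V), (∀ e f, Dep route e f → f ∈ D → e ∈ D) ∧
      IsGlobalAttractor src tgt D v ∧ ∀ e ∈ D, src e ≠ v := by
  let P : Set E → Prop := fun D =>
    (∀ e f, Dep route e f → f ∈ D → e ∈ D) ∧ ∃ v, IsGlobalAttractor src tgt D v
  obtain ⟨D, ⟨hclosed, v, hv⟩, hmin⟩ : ∃ D, P D ∧ ∀ D', P D' → ¬ D' ⊂ D := by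
    obtain ⟨D, hD, hmin⟩ := (wellFounded_lt (α := Set E)).has_min {D | P D}
      ⟨Set.univ, fun _ _ _ _ => Set.mem_univ _, Classical.arbitrary V,
        fun u hu => hconn u _ hu⟩
    exact ⟨D, hD, hmin⟩
  refine ⟨D, v, hclosed, hv, fun e₀ he₀ hev => ?_⟩
  let R : E → E → Prop := fun e f => Relation.TransGen (Dep route) f e
  have : IsTrans E R := ⟨fun _ _ _ h₁ h₂ => h₂.trans h₁⟩
  have : Std.Irrefl R := ⟨fun e => hdf e⟩
  obtain ⟨e, ⟨heD, heC⟩, hemax⟩ := (Finite.wellFounded_of_trans_of_irrefl R).has_min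
    {e | e ∈ D ∧ ∀ u, Relation.ReflTransGen (Step src tgt D) u (src e)}
    ⟨e₀, he₀, by rw [hev]; exact hv.reflTransGen⟩
  refine hmin (D \ {e}) ⟨?_, src e, ?_⟩ ⟨Set.sdiff_subset, fun h => (h heD).2 rfl⟩
  · rintro a b hab ⟨hbD, -⟩
    refine ⟨hclosed a b hab hbD, ?_⟩
    rintro rfl
    refine hemax b ⟨hbD, fun u => ?_⟩ (.single hab)
    rw [← hab.tgt_eq_src hroute]
    exact (heC u).tail ⟨a, heD, rfl, rfl⟩
  · exact fun u hu => reachableVia_of_reflTransGen hu (reflTransGen_step_diff (heC u))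

/-- If a network admits a deadlock-free routing scheme, then it contains two
edge-disjoint directed spanning trees rooted at a common vertex, one directed into
the root and the other directed away from it. -/
theorem deadlockFree_routing_gives_two_trees
    {V E : Type*} [Fintype V] [Nonempty V] [Fintype E] (src tgt : E → V)
    (hloop : ∀ e : E, src e ≠ tgt e) (hconn : StronglyConnected src tgt)
    (route : ∀ u w : V, u ≠ w → List E)
    (hroute : IsRouting src tgt route) (hdf : DeadlockFree route) :
    ∃ (v : V) (Tin Tout : Finset E), IsInTree src tgt v Tin ∧ IsOutTree src tgt v Tout ∧
      Disjoint Tin Tout := by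
  obtain ⟨D, v, hclosed, hv, hout⟩ := exists_attractor_without_outgoing hconn hroute hdf
  have hreach : ∀ w, w ≠ v → ReachableVia src tgt Dᶜ v w := by
    intro w hw
    have hpath := hroute v w hw.symm
    refine ⟨route v w hw.symm, (isChain_dep_route route v w hw.symm).induction (· ∈ Dᶜ) _
      (fun a b hab ha hb => ha (hclosed a b hab hb)) fun hne hD => hout _ hD ?_, hpath⟩
    have hhead := hpath.2.2.1
    rw [List.head?_eq_some_head hne] at hhead
    simpa using hhead
  obtain ⟨Tin, hTin, hin⟩ := exists_isInTree hv
  obtain ⟨Tout, hTout, hout'⟩ := exists_isOutTree hreach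
  exact ⟨v, Tin, Tout, hin, hout',
    Finset.disjoint_left.2 fun e he he' => hTout he' (hTin he)⟩
end

section
/- Let G be a network (a finite, strongly connected directed multigraph without self-loops) with a routing scheme, let ≤ be a linear order on E that respects the routing scheme, and let E_s be the set of the s smallest edges for some 1 ≤ s ≤ |E|. If a vertex v has no outgoing edge in E_s (no e ∈ E_s with src e = v), then for every vertex w ≠ v the routing path from v to w uses no edge of E_s. -/
/-- The `s` smallest edges form an initial segment of the order. -/
theorem mem_smallestEdges_of_le {E : Type*} [Finite E] {ord : LinearOrder E} {s : ℕ} {a b : E}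
    (hab : ord.le a b) (hb : b ∈ smallestEdges ord s) : a ∈ smallestEdges ord s :=
  (Set.ncard_le_ncard (fun _ hx => ord.le_trans _ _ _ hx hab) (Set.toFinite _)).trans hb

/-- Along a routing path, the edges strictly increase in any order respecting the routing. -/
theorem RespectsRouting.pairwise_lt {V E : Type*} {route : ∀ u w : V, u ≠ w → List E}
    {ord : LinearOrder E} (hresp : RespectsRouting route ord) (u w : V) (h : u ≠ w) :
    (route u w h).Pairwise ord.lt := by
  have : IsTrans E ord.lt := ⟨fun _ _ _ => lt_trans (α := E)⟩
  refine List.IsChain.pairwise (List.isChain_iff_forall_rel_of_append_cons_cons.2 ?_)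
  intro a b l₁ l₂ hl
  exact hresp a b ⟨u, w, h, l₁, l₂, by simp [hl]⟩

/-- If a vertex `v` has no outgoing edge among the `s` smallest edges of a linear order
respecting a routing scheme, then no routing path starting at `v` uses any of those
edges. -/
theorem no_small_out_edges_routes_avoid_prefix
    {V E : Type*} [Fintype V] [Nonempty V] [Fintype E] (src tgt : E → V)
    (hloop : ∀ e : E, src e ≠ tgt e) (hconn : StronglyConnected src tgt)
    (route : ∀ u w : V, u ≠ w → List E) (hroute : IsRouting src tgt route)
    (ord : LinearOrder E) (hresp : RespectsRouting route ord)
    (s : ℕ) (hs₁ : 1 ≤ s) (hs₂ : s ≤ Fintype.card E)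
    (v : V) (hv : ∀ e ∈ smallestEdges ord s, src e ≠ v) :
    ∀ (w : V) (h : v ≠ w), ∀ e ∈ route v w h, e ∉ smallestEdges ord s := by
  intro w h e he hes
  obtain ⟨hne, -, hhead, -⟩ := hroute v w h
  have hpw := hresp.pairwise_lt v w h
  cases hp : route v w h with
  | nil => exact hne hp
  | cons a l =>
    rw [hp] at he hhead hpw
    have hle : ord.le a e := by
      rcases List.mem_cons.1 he with rfl | hel
      · exact ord.le_refl _
      · exact le_of_lt (List.rel_of_pairwise_cons hpw hel)
    exact hv a (mem_smallestEdges_of_le hle hes) (by simpa using hhead)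
end
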